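/- Let 𝔤 be a finite-dimensional Lie algebra over an algebraically closed field k of characteristic zero, and let 𝔷 be the center of 𝔤. Then for every linear functional f : 𝔷 → k there exists a simple left U(𝔤)-module M such that every z ∈ 𝔷 acts on M as multiplication by the scalar f(z). (Consequently, the canonical map from the chain group C(𝔤) to 𝔷* sending the generator of an irreducible representation to the restriction of its central character to 𝔷 is surjective.) -/

import Mathlib

universe u
namespace CentralChar
open TensorProduct MvPowerSeries
set_option linter.unusedSectionVars false

/-- The Lie bracket as a bilinear map. -/
noncomputable def br (A : Type*) {V : Type*} [CommRing A] [LieRing V] [LieAlgebra A V] :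
    V →ₗ[A] V →ₗ[A] V := (LieModule.toEnd A V V : V →ₗ[A] Module.End A V)

section
variable {A : Type*} {V : Type*} [CommRing A] [LieRing V] [LieAlgebra A V]
lemma br_apply (u w : V) : br A u w = ⁅u, w⁆ := rfl
lemma br_skew (u w : V) : br A u w = - br A w u := by
  rw [br_apply, br_apply, lie_skew]
lemma br_jac (u v w : V) : br A u (br A v w) = br A (br A u v) w + br A v (br A u w) := by
  simp only [br_apply]; exact leibniz_lie u v w
end

variable {k : Type u} [Field k] {L : Type u} [LieRing L] [LieAlgebra k L]
variable {σ : Type} [Fintype σ] [DecidableEq σ]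

/-- Coefficientwise extension of a derivation to the base change of `L`. -/
noncomputable def ext {A : Type u} [CommRing A] [Algebra k A] (D : Derivation k A A) :
    A ⊗[k] L →ₗ[k] A ⊗[k] L := (D : A →ₗ[k] A).rTensor L

section
variable {A : Type u} [CommRing A] [Algebra k A] (D : Derivation k A A)

lemma br_tmul (a c : A) (x y : L) :
    br A (a ⊗ₜ[k] x) (c ⊗ₜ[k] y) = (a * c) ⊗ₜ[k] ⁅x, y⁆ := rfl

@[simp] lemma ext_tmul (a : A) (x : L) : ext D (a ⊗ₜ[k] x) = D a ⊗ₜ x := rfl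

lemma ext_smul (a : A) (u : A ⊗[k] L) : ext D (a • u) = D a • u + a • ext D u := by
  induction u with
  | zero => simp
  | add u w hu hw => simp only [smul_add, map_add, hu, hw]; abel
  | tmul c x =>
    simp [TensorProduct.smul_tmul', add_tmul, mul_comm c, add_comm]

lemma ext_lie (u w : A ⊗[k] L) : ext D (br A u w) = br A (ext D u) w + br A u (ext D w) := by
  induction u with
  | zero => simp
  | add u u' hu hw => simp only [LinearMap.add_apply, map_add, hu, hw]; abel
  | tmul c x =>
    induction w with
    | zero => simp
    | add u u' hu hw => simp only [map_add, hu, hw]; abel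
    | tmul d y => simp [br_tmul, add_tmul, mul_comm d, add_comm]

end

/-- Euler derivation. -/
noncomputable def eul : Derivation k (MvPowerSeries σ k) (MvPowerSeries σ k) :=
  ∑ i, (X i : MvPowerSeries σ k) • pderiv k i

lemma coeff_X_mul_add (m : σ →₀ ℕ) (i : σ) (a : MvPowerSeries σ k) :
    coeff (m + Finsupp.single i 1) (X i * a) = coeff m a := by
  rw [X, add_comm, coeff_add_monomial_mul, one_mul]

lemma coeff_X_mul_zero (m : σ →₀ ℕ) (i : σ) (h : m i = 0) (a : MvPowerSeries σ k) :
    coeff m (X i * a) = 0 := by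
  rw [X, coeff_monomial_mul, if_neg]
  intro h'
  have := h' i
  simp [h] at this

lemma exists_add (m : σ →₀ ℕ) (i : σ) (h : m i ≠ 0) : m - Finsupp.single i 1 + Finsupp.single i 1 = m := by
  apply tsub_add_cancel_of_le
  simpa [Nat.one_le_iff_ne_zero] using h

lemma coeff_X_mul' (m : σ →₀ ℕ) (i : σ) (a : MvPowerSeries σ k) :
    coeff m (X i * a) = if m i = 0 then 0 else coeff (m - Finsupp.single i 1) a := by
  split_ifs with h
  · exact coeff_X_mul_zero m i h a
  · conv_lhs => rw [← exists_add m i h]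
    exact coeff_X_mul_add _ _ _

lemma coeff_eul (m : σ →₀ ℕ) (a : MvPowerSeries σ k) :
    coeff m (eul a) = (m.degree : k) * coeff m a := by
  have : (eul a) = ∑ i, X i * pderiv k i a := by
    have h : ∀ s : Finset σ, (∑ i ∈ s, (X i : MvPowerSeries σ k) • pderiv k i) a
        = ∑ i ∈ s, X i * pderiv k i a := by
      intro s
      induction s using Finset.induction_on with
      | empty => simp
      | insert j s hj ih => rw [Finset.sum_insert hj, Finset.sum_insert hj, Derivation.add_apply, ih]; rfl
    exact h _
  rw [this, map_sum, Finsupp.degree_eq_sum, Nat.cast_sum, Finset.sum_mul]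
  refine Finset.sum_congr rfl fun i _ => ?_
  rw [coeff_X_mul']
  split_ifs with h
  · simp [h]
  · rw [coeff_pderiv, exists_add m i h]
    have : 1 ≤ m i := Nat.one_le_iff_ne_zero.2 h
    simp [Nat.cast_sub this, mul_comm]

lemma eul_pderiv (i : σ) (a : MvPowerSeries σ k) :
    eul (pderiv k i a) = pderiv k i (eul a) - pderiv k i a := by
  ext m
  rw [map_sub]
  simp only [coeff_eul, coeff_pderiv, map_add, Finsupp.degree_single]
  push_cast
  ring

lemma pderiv_comm' (i j : σ) (a : MvPowerSeries σ k) :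
    pderiv k i (pderiv k j a) = pderiv k j (pderiv k i a) := by
  ext m
  simp only [coeff_pderiv]
  rcases eq_or_ne i j with rfl | h
  · rfl
  · simp [h, h.symm, add_right_comm m]
    ring

/-- `L`-valued coefficient. -/
noncomputable def cL (m : σ →₀ ℕ) : MvPowerSeries σ k ⊗[k] L →ₗ[k] L :=
  (TensorProduct.lid k L).toLinearMap ∘ₗ (coeff (R := k) m).rTensor L

@[simp] lemma cL_tmul (m : σ →₀ ℕ) (a : MvPowerSeries σ k) (x : L) :
    cL m (a ⊗ₜ[k] x) = coeff m a • x := by simp [cL]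

lemma cL_eul (m : σ →₀ ℕ) (u : MvPowerSeries σ k ⊗[k] L) :
    cL m (ext eul u) = (m.degree : k) • cL m u := by
  induction u with
  | zero => simp
  | add u w hu hw => simp only [smul_add, map_add, hu, hw]
  | tmul c x => simp [coeff_eul, mul_smul]

lemma ext_eul_pderiv (i : σ) (u : MvPowerSeries σ k ⊗[k] L) :
    ext eul (ext (pderiv k i) u) = ext (pderiv k i) (ext eul u) - ext (pderiv k i) u := by
  induction u with
  | zero => simp
  | add u w hu hw => simp only [map_add, hu, hw]; abel
  | tmul c x => simp [eul_pderiv, sub_tmul]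

variable (b : Module.Basis σ k L)

/-- generic point -/
noncomputable def gen : MvPowerSeries σ k ⊗[k] L := ∑ i, X i ⊗ₜ b i

lemma cL_gen_lie (m : σ →₀ ℕ) (u : MvPowerSeries σ k ⊗[k] L) :
    cL m (br (MvPowerSeries σ k) (gen b) u) = ∑ i, if m i = 0 then 0 else ⁅b i, cL (m - Finsupp.single i 1) u⁆ := by
  rw [gen, map_sum, LinearMap.sum_apply, map_sum]
  refine Finset.sum_congr rfl fun i _ => ?_
  induction u with
  | zero => simp
  | add u w hu hw => simp only [map_add, hu, hw]; split_ifs <;> simp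
  | tmul c x =>
    simp only [br_tmul, cL_tmul, coeff_X_mul']
    split_ifs <;> simp

lemma pderiv_gen (i : σ) : ext (pderiv k i) (gen b) = (1 : MvPowerSeries σ k) ⊗ₜ b i := by
  rw [gen, map_sum, Finset.sum_eq_single i]
  · simp
  · intro j _ h
    rw [ext_tmul, pderiv_X_of_ne h, zero_tmul]
  · simp

lemma eul_gen : ext eul (gen b) = gen b := by
  rw [gen, map_sum]
  refine Finset.sum_congr rfl fun i _ => ?_
  rw [ext_tmul]
  congr 1
  ext m
  rw [coeff_eul, coeff_X]
  split_ifs with h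
  · simp [h]
  · simp

/-- element from coefficients -/
noncomputable def mkL (g : (σ →₀ ℕ) → L) : MvPowerSeries σ k ⊗[k] L :=
  ∑ j, (show MvPowerSeries σ k from fun m => b.repr (g m) j) ⊗ₜ b j

lemma cL_mkL (g : (σ →₀ ℕ) → L) (m : σ →₀ ℕ) : cL m (mkL b g) = g m := by
  rw [mkL, map_sum]
  exact b.sum_repr (g m)

lemma repr_coeff (u : MvPowerSeries σ k ⊗[k] L) (m : σ →₀ ℕ) (j : σ) :
    coeff m ((Algebra.TensorProduct.basis (MvPowerSeries σ k) b).repr u j) = b.repr (cL m u) j := by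
  induction u with
  | zero => simp
  | add u w hu hw => simp only [map_add, Finsupp.add_apply, hu, hw]
  | tmul c x =>
    rw [Algebra.TensorProduct.basis_repr_tmul]
    rw [cL_tmul, map_smul]
    exact coeff_mul_C m c (b.repr x j)

lemma cL_ext {u w : MvPowerSeries σ k ⊗[k] L} (h : ∀ m, cL m u = cL m w) (b : Module.Basis σ k L) :
    u = w := by
  apply (Algebra.TensorProduct.basis (MvPowerSeries σ k) b).repr.injective
  ext j m
  rw [repr_coeff, repr_coeff, h]

/-- recursive coefficients -/
noncomputable def thc (v : L) : ℕ → (σ →₀ ℕ) → L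
  | 0, _ => v
  | n + 1, m => -((n + 2 : k)⁻¹ • ∑ i, if m i = 0 then 0 else
      ⁅b i, thc v n (m - Finsupp.single i 1)⁆)

/-- Maurer-Cartan form -/
noncomputable def th (v : L) : MvPowerSeries σ k ⊗[k] L := mkL b fun m => thc b v m.degree m

lemma deg_sub (m : σ →₀ ℕ) (i : σ) (h : m i ≠ 0) :
    m.degree = (m - Finsupp.single i 1).degree + 1 := by
  conv_lhs => rw [← exists_add m i h]
  simp

lemma th_eq [CharZero k] (v : L) :
    ext eul (th b v) + th b v = 1 ⊗ₜ v - br (MvPowerSeries σ k) (gen b) (th b v) := by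
  apply cL_ext _ b
  intro m
  rw [map_add, map_sub, cL_gen_lie, cL_eul]
  simp only [th, cL_mkL, cL_tmul]
  rcases hm : m.degree with _ | n
  · have : m = 0 := (Finsupp.degree_eq_zero_iff m).1 hm
    subst this
    simp [thc]
  · have h0 : m ≠ 0 := by rintro rfl; simp at hm
    rw [coeff_one, if_neg h0, zero_smul, zero_sub]
    have : ∀ i, (if m i = 0 then (0 : L) else ⁅b i, thc b v (m - Finsupp.single i 1).degree (m - Finsupp.single i 1)⁆)
        = if m i = 0 then (0 : L) else ⁅b i, thc b v n (m - Finsupp.single i 1)⁆ := by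
      intro i
      split_ifs with h
      · rfl
      · have := deg_sub m i h
        have h' : (m - Finsupp.single i 1).degree = n := by omega
        rw [h']
    rw [Finset.sum_congr rfl fun i _ => this i, thc]
    generalize (∑ i, if m i = 0 then (0 : L) else ⁅b i, thc b v n (m - Finsupp.single i 1)⁆) = S
    have h2 : (n + 2 : k) ≠ 0 := by exact_mod_cast (by omega : n + 2 ≠ 0)
    push_cast
    rw [← smul_neg, smul_smul, ← add_smul (_ * _)]
    rw [show ((n : k) + 1) * (n + 2 : k)⁻¹ + (n + 2 : k)⁻¹ = 1 by field_simp; ring, one_smul]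

/-- uniqueness -/
lemma uniq [CharZero k] (c : ℕ) (hc : c ≠ 0) (F : MvPowerSeries σ k ⊗[k] L)
    (h : ext eul F + (c : k) • F = -(br (MvPowerSeries σ k) (gen b) F)) : F = 0 := by
  apply cL_ext _ b
  have : ∀ n, ∀ m : σ →₀ ℕ, m.degree = n → cL m F = 0 := by
    intro n
    induction n with
    | zero =>
      intro m hm
      have : m = 0 := (Finsupp.degree_eq_zero_iff m).1 hm
      subst this
      have := congrArg (cL 0) h
      rw [map_add, cL_eul, map_neg, cL_gen_lie] at this
      simpa [hc] using this
    | succ n ih =>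
      intro m hm
      have := congrArg (cL m) h
      rw [map_add, cL_eul, map_neg, cL_gen_lie, Finset.sum_eq_zero, neg_zero, map_smul,
        ← add_smul] at this
      · refine (smul_eq_zero.1 this).resolve_left ?_
        exact_mod_cast (by omega)
      · intro i _
        split_ifs with h
        · rfl
        · rw [ih, lie_zero]
          have := deg_sub m i h
          omega
  intro m
  rw [this _ m rfl, map_zero]

lemma th_center [CharZero k] (v : L) (hv : ∀ x : L, ⁅x, v⁆ = 0) : th b v = 1 ⊗ₜ v := by
  rw [← sub_eq_zero]
  apply uniq b 1 one_ne_zero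
  have h1 := th_eq b v
  have h2 : br (MvPowerSeries σ k) (gen b) (1 ⊗ₜ[k] v) = 0 := by
    rw [gen, map_sum, LinearMap.sum_apply]
    exact Finset.sum_eq_zero fun i _ => by simp [br_tmul, hv]
  rw [map_sub, map_sub, h2, ext_tmul, Derivation.map_one_eq_zero, zero_tmul]
  rw [Nat.cast_one, one_smul, sub_zero, sub_zero, ← add_sub_assoc, h1]
  abel

lemma mc [CharZero k] (v w : σ) :
    ext (pderiv k v) (th b (b w)) - ext (pderiv k w) (th b (b v)) + br (MvPowerSeries σ k) (th b (b v)) (th b (b w)) = 0 := by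
  apply uniq b 2 two_ne_zero
  have key : ∀ v, ext eul (th b v) = 1 ⊗ₜ v - br (MvPowerSeries σ k) (gen b) (th b v) - th b v := fun v =>
    eq_sub_of_add_eq (th_eq b v)
  have jac := br_jac (A := MvPowerSeries σ k) (gen b) (th b (b v)) (th b (b w))
  rw [map_add, map_sub, ext_eul_pderiv, ext_eul_pderiv, ext_lie, key, key]
  simp only [map_sub, map_add, ext_lie, pderiv_gen, ext_tmul, pderiv_one, zero_tmul, LinearMap.sub_apply, jac]
  rw [br_skew (th b (b v)) ((1 : MvPowerSeries σ k) ⊗ₜ[k] (b w))]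
  simp only [Nat.cast_ofNat, two_smul]
  abel

lemma th_sum_center [CharZero k] (v : L) (hv : ∀ x : L, ⁅x, v⁆ = 0) :
    ∑ i, b.repr v i • th b (b i) = 1 ⊗ₜ v := by
  rw [← sub_eq_zero]
  apply uniq b 1 one_ne_zero
  have h1 : ext eul (∑ i, b.repr v i • th b (b i)) + ∑ i, b.repr v i • th b (b i)
      = 1 ⊗ₜ v - br (MvPowerSeries σ k) (gen b) (∑ i, b.repr v i • th b (b i)) := by
    have h3 : (1 : MvPowerSeries σ k) ⊗ₜ[k] v = ∑ i, b.repr v i • (1 ⊗ₜ[k] b i) := by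
      conv_lhs => rw [← b.sum_repr v]
      rw [TensorProduct.tmul_sum]
      simp only [TensorProduct.tmul_smul]
    rw [h3, map_sum, map_sum, ← Finset.sum_add_distrib, ← Finset.sum_sub_distrib]
    refine Finset.sum_congr rfl fun i _ => ?_
    rw [map_smul, LinearMap.map_smul_of_tower, ← smul_add, th_eq]
    exact smul_sub (b.repr v i) _ _
  have h2 : br (MvPowerSeries σ k) (gen b) (1 ⊗ₜ[k] v) = 0 := by
    rw [gen, map_sum, LinearMap.sum_apply]
    exact Finset.sum_eq_zero fun i _ => by simp [br_tmul, hv]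
  rw [map_sub, map_sub, h2, ext_tmul, Derivation.map_one_eq_zero, zero_tmul]
  rw [Nat.cast_one, one_smul, sub_zero, sub_zero, ← add_sub_assoc, h1]
  abel

/-- The basis of the base change. -/
noncomputable abbrev bb : Module.Basis σ (MvPowerSeries σ k) (MvPowerSeries σ k ⊗[k] L) :=
  Algebra.TensorProduct.basis (MvPowerSeries σ k) b

/-- The Maurer-Cartan form as a linear map. -/
noncomputable def Th : MvPowerSeries σ k ⊗[k] L →ₗ[MvPowerSeries σ k] MvPowerSeries σ k ⊗[k] L :=
  (bb b).constr (MvPowerSeries σ k) fun i => th b (b i)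

lemma Th_apply (u : MvPowerSeries σ k ⊗[k] L) :
    Th b u = ∑ i, (bb b).repr u i • th b (b i) := by
  rw [Th, Module.Basis.constr_apply_fintype]; rfl

lemma cL_zero_th (v : L) : cL 0 (th b v) = v := by
  rw [th, cL_mkL]; simp [thc]

lemma isUnit_Th : IsUnit (Th b) := by
  rw [← LinearMap.isUnit_toMatrix_iff (bb b), Matrix.isUnit_iff_isUnit_det,
    isUnit_iff_constantCoeff, RingHom.map_det]
  convert isUnit_one
  rw [← Matrix.det_one (n := σ)]
  congr 1
  ext i j
  rw [RingHom.mapMatrix_apply, Matrix.map_apply, LinearMap.toMatrix_apply,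
    ← coeff_zero_eq_constantCoeff_apply, repr_coeff, Th, Module.Basis.constr_basis, cL_zero_th,
    Module.Basis.repr_self, Finsupp.single_apply, Matrix.one_apply]
  simp only [eq_comm]

lemma exists_xi (x : L) : ∃ u, Th b u = 1 ⊗ₜ x := by
  have h := isUnit_Th b
  rw [Module.End.isUnit_iff] at h
  exact h.2 _

lemma Th_inj : Function.Injective (Th b) := by
  have h := isUnit_Th b
  rw [Module.End.isUnit_iff] at h
  exact h.1

/-- Invariant vector field. -/
noncomputable def xi (x : L) : MvPowerSeries σ k ⊗[k] L := (exists_xi b x).choose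

lemma Th_xi (x : L) : Th b (xi b x) = 1 ⊗ₜ x := (exists_xi b x).choose_spec

lemma xi_add (x y : L) : xi b (x + y) = xi b x + xi b y := by
  apply Th_inj b
  rw [map_add, Th_xi, Th_xi, Th_xi, tmul_add]

lemma xi_smul (c : k) (x : L) : xi b (c • x) = c • xi b x := by
  apply Th_inj b
  rw [LinearMap.map_smul_of_tower, Th_xi, Th_xi, tmul_smul]

/-- coordinates of the invariant vector field. -/
noncomputable def co (x : L) (j : σ) : MvPowerSeries σ k := (bb b).repr (xi b x) j

lemma co_eq (x : L) : ∑ i, co b x i • th b (b i) = 1 ⊗ₜ x := by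
  rw [← Th_xi b x, Th_apply]; rfl

lemma co_uniq (x : L) (c : σ → MvPowerSeries σ k) (h : ∑ i, c i • th b (b i) = 1 ⊗ₜ x) (j : σ) :
    c j = co b x j := by
  have : xi b x = (bb b).equivFun.symm c := by
    apply Th_inj b
    rw [Th_xi, Th_apply, ← h]
    refine Finset.sum_congr rfl fun i _ => ?_
    rw [← Module.Basis.equivFun_apply, LinearEquiv.apply_symm_apply]
  rw [co, this, ← Module.Basis.equivFun_apply, LinearEquiv.apply_symm_apply]

lemma co_add (x y : L) (j : σ) : co b (x + y) j = co b x j + co b y j := by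
  rw [co, xi_add]; simp [co]

lemma co_smul (c : k) (x : L) (j : σ) : co b (c • x) j = c • co b x j := by
  symm
  refine co_uniq b _ (fun j => c • co b x j) ?_ j
  simp only [smul_assoc]
  rw [← Finset.smul_sum, co_eq, tmul_smul]

lemma co_center [CharZero k] (v : L) (hv : ∀ x : L, ⁅x, v⁆ = 0) (j : σ) :
    co b v j = algebraMap k _ (b.repr v j) := by
  symm
  refine co_uniq b _ (fun j => algebraMap k _ (b.repr v j)) ?_ j
  simp only [algebraMap_smul]
  exact th_sum_center b v hv

lemma co_lie [CharZero k] (x y : L) (j : σ) :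
    ∑ i, (co b x i * pderiv k i (co b y j) - co b y i * pderiv k i (co b x j)) = co b ⁅x, y⁆ j := by
  refine co_uniq b _ (fun j => ∑ i, (co b x i * pderiv k i (co b y j)
    - co b y i * pderiv k i (co b x j))) ?_ j
  have h : ∀ x y : L, ∑ i, ∑ j, ((co b x i * pderiv k i (co b y j)) • th b (b j) +
      (co b x i * co b y j) • ext (pderiv k i) (th b (b j))) = 0 := by
    intro x y
    refine Finset.sum_eq_zero fun i _ => ?_
    have := congrArg (fun u => co b x i • ext (pderiv k i) u) (co_eq b y)
    simp only [map_sum, ext_smul, ext_tmul, pderiv_one, zero_tmul, smul_zero, Finset.smul_sum,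
      smul_add, smul_smul] at this
    exact this
  have h1 := h x y
  have h2 := h y x
  simp only [Finset.sum_add_distrib] at h1 h2
  have h3 : (1 : MvPowerSeries σ k) ⊗ₜ[k] ⁅x, y⁆ =
      ∑ i, ∑ j, (co b x i * co b y j) • br (MvPowerSeries σ k) (th b (b i)) (th b (b j)) := by
    have : (1 : MvPowerSeries σ k) ⊗ₜ[k] ⁅x, y⁆ = br (MvPowerSeries σ k) (1 ⊗ₜ[k] x) (1 ⊗ₜ[k] y) := by
      rw [br_tmul, one_mul]
    rw [this, ← co_eq b x, ← co_eq b y, map_sum (br (MvPowerSeries σ k)), LinearMap.sum_apply]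
    refine Finset.sum_congr rfl fun i _ => ?_
    rw [map_sum]
    refine Finset.sum_congr rfl fun j _ => ?_
    rw [map_smul, map_smul, LinearMap.smul_apply, smul_smul, mul_comm]
  have h4 : ∑ i, ∑ j, (co b y i * co b x j) • ext (pderiv k i) (th b (b j))
      = ∑ i, ∑ j, (co b x i * co b y j) • ext (pderiv k j) (th b (b i)) := by
    rw [Finset.sum_comm]
    simp only [mul_comm]
  have h5 : ∀ i j, br (MvPowerSeries σ k) (th b (b i)) (th b (b j)) =
      ext (pderiv k j) (th b (b i)) - ext (pderiv k i) (th b (b j)) := by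
    intro i j
    rw [eq_sub_iff_add_eq, ← sub_eq_zero, ← mc b i j]
    abel
  rw [h4] at h2
  rw [h3]
  have h6 : ∀ x y : L, ∑ j, (∑ i, co b x i * pderiv k i (co b y j)) • th b (b j) =
      ∑ i, ∑ j, (co b x i * pderiv k i (co b y j)) • th b (b j) := by
    intro x y
    rw [Finset.sum_comm]
    exact Finset.sum_congr rfl fun j _ => Finset.sum_smul
  simp only [h5, smul_sub, Finset.sum_sub_distrib]
  have h7 : ∀ (p q : MvPowerSeries σ k) (u : MvPowerSeries σ k ⊗[k] L),
      (p - q) • u = p • u - q • u := fun p q u => sub_smul p q u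
  simp only [h7, Finset.sum_sub_distrib]
  rw [h6, h6, eq_neg_of_add_eq_zero_left h1, eq_neg_of_add_eq_zero_left h2]
  abel

variable (f : L →ₗ[k] k)

/-- twisted derivative -/
noncomputable def tw (j : σ) (a : MvPowerSeries σ k) : MvPowerSeries σ k :=
  pderiv k j a + f (b j) • a

lemma tw_comm (i j : σ) (a : MvPowerSeries σ k) : tw b f i (tw b f j a) = tw b f j (tw b f i a) := by
  simp only [tw, map_add, Derivation.map_smul, smul_add, pderiv_comm' i j, smul_comm (f (b i))]
  abel

lemma tw_mul (i : σ) (c a : MvPowerSeries σ k) :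
    tw b f i (c * a) = pderiv k i c * a + c * tw b f i a := by
  simp only [tw, Derivation.leibniz, smul_eq_mul, mul_add, mul_smul_comm]
  ring

/-- The operator attached to an element of `L`. -/
noncomputable def op (x : L) : Module.End k (MvPowerSeries σ k) where
  toFun a := ∑ j, co b x j * tw b f j a
  map_add' a c := by
    rw [← Finset.sum_add_distrib]
    refine Finset.sum_congr rfl fun i _ => ?_
    simp only [tw, map_add, smul_add]; ring
  map_smul' r a := by
    rw [Finset.smul_sum]
    refine Finset.sum_congr rfl fun i _ => ?_
    simp only [tw, Derivation.map_smul, smul_add, mul_add, RingHom.id_apply, mul_smul_comm,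
      smul_comm r]

lemma op_apply (x : L) (a : MvPowerSeries σ k) : op b f x a = ∑ j, co b x j * tw b f j a := rfl

lemma op_lie [CharZero k] (x y : L) (a : MvPowerSeries σ k) :
    op b f ⁅x, y⁆ a = op b f x (op b f y a) - op b f y (op b f x a) := by
  have h : ∀ x y, op b f x (op b f y a) = ∑ j, (∑ i, co b x i * pderiv k i (co b y j)) * tw b f j a +
      ∑ i, ∑ j, co b x i * co b y j * tw b f i (tw b f j a) := by
    intro x y
    have hs : ∀ i, tw b f i (∑ j, co b y j * tw b f j a) = ∑ j, tw b f i (co b y j * tw b f j a) := by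
      intro i
      simp only [tw, map_sum, Finset.smul_sum, Finset.sum_add_distrib]
    simp only [op_apply, hs, tw_mul, Finset.mul_sum, mul_add, Finset.sum_add_distrib, Finset.sum_mul,
      mul_assoc]
    rw [Finset.sum_comm (γ := σ)]
  have h2 : ∑ i, ∑ j, co b x i * co b y j * tw b f i (tw b f j a) =
      ∑ i, ∑ j, co b y i * co b x j * tw b f i (tw b f j a) := by
    rw [Finset.sum_comm]
    refine Finset.sum_congr rfl fun i _ => Finset.sum_congr rfl fun j _ => ?_
    rw [tw_comm, mul_comm (co b x j)]
  rw [h, h, h2, add_sub_add_right_eq_sub, ← Finset.sum_sub_distrib, op_apply]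
  refine Finset.sum_congr rfl fun j _ => ?_
  rw [← sub_mul, ← Finset.sum_sub_distrib, co_lie]

attribute [local instance] LieRing.ofAssociativeRing

/-- The representation. -/
noncomputable def rep [CharZero k] : L →ₗ⁅k⁆ Module.End k (MvPowerSeries σ k) where
  toFun := op b f
  map_add' x y := by
    ext1 a
    simp [op_apply, co_add, add_mul, Finset.sum_add_distrib]
  map_smul' c x := by
    ext1 a
    simp [op_apply, co_smul, Finset.smul_sum]
  map_lie' {x y} := by
    ext1 a
    exact op_lie b f x y a

lemma rep_center [CharZero k] (v : L) (hv : ∀ x : L, ⁅x, v⁆ = 0) :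
    rep b f v 1 = f v • (1 : MvPowerSeries σ k) := by
  change ∑ j, co b v j * tw b f j 1 = _
  conv_rhs => rw [← b.sum_repr v]
  rw [map_sum, Finset.sum_smul]
  refine Finset.sum_congr rfl fun j _ => ?_
  rw [co_center b v hv, tw, pderiv_one, zero_add, ← Algebra.smul_def, smul_smul, map_smul, smul_eq_mul]

lemma central_comm (z : L) (hz : ∀ x : L, ⁅x, z⁆ = 0) : ∀ w : UniversalEnvelopingAlgebra k L,
    UniversalEnvelopingAlgebra.ι k z * w = w * UniversalEnvelopingAlgebra.ι k z := by
  intro w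
  obtain ⟨t, rfl⟩ : ∃ t, UniversalEnvelopingAlgebra.mkAlgHom k L t = w :=
    Quotient.exists_rep w
  induction t using TensorAlgebra.induction with
  | algebraMap r => rw [AlgHom.commutes, Algebra.commutes]
  | ι x =>
    rw [← UniversalEnvelopingAlgebra.ι_apply, ← sub_eq_zero,
      ← LieRing.of_associative_ring_bracket, ← LieHom.map_lie, ← lie_skew, hz x]
    simp
  | mul p q hp hq => rw [map_mul, ← mul_assoc, hp, mul_assoc, hq, mul_assoc]
  | add p q hp hq => rw [map_add, mul_add, add_mul, hp, hq]

end CentralChar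

/-- For a finite-dimensional Lie algebra over an algebraically closed field of
characteristic zero, every linear functional on the center arises as the central character of
some simple module over the universal enveloping algebra. -/
theorem exists_simpleModule_with_central_character
    (k : Type u) [Field k] [IsAlgClosed k] [CharZero k]
    (L : Type u) [LieRing L] [LieAlgebra k L] [FiniteDimensional k L]
    (f : Module.Dual k ↥(LieAlgebra.center k L)) :
    ∃ (M : Type u) (_ : AddCommGroup M) (_ : Module (UniversalEnvelopingAlgebra k L) M),
      IsSimpleModule (UniversalEnvelopingAlgebra k L) M ∧
      ∀ (z : ↥(LieAlgebra.center k L)) (m : M),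
        (UniversalEnvelopingAlgebra.ι k (z : L)) • m =
          algebraMap k (UniversalEnvelopingAlgebra k L) (f z) • m := by
  classical
  obtain ⟨g, hg⟩ := LinearMap.exists_extend (p := (LieAlgebra.center k L).toSubmodule) f
  have hg' : ∀ z : ↥(LieAlgebra.center k L), g (z : L) = f z := fun z => LinearMap.congr_fun hg z
  have hz : ∀ z : ↥(LieAlgebra.center k L), ∀ x : L, ⁅x, (z : L)⁆ = 0 := fun z =>
    (LieModule.mem_maxTrivSubmodule k L L (z : L)).1 z.2
  let b := Module.finBasis k L
  let φ := UniversalEnvelopingAlgebra.lift k (CentralChar.rep b g)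
  let J : Submodule (UniversalEnvelopingAlgebra k L) (UniversalEnvelopingAlgebra k L) :=
    { carrier := {u | φ u 1 = 0}
      add_mem' := fun {u w} hu hw => by
        simp only [Set.mem_ofPred_eq] at *
        rw [map_add, LinearMap.add_apply, hu, hw, add_zero]
      zero_mem' := by simp
      smul_mem' := fun c u hu => by
        simp only [Set.mem_ofPred_eq] at *
        rw [smul_eq_mul, map_mul, Module.End.mul_apply, hu, map_zero] }
  have hJ : J ≠ ⊤ := by
    intro h
    have : (1 : UniversalEnvelopingAlgebra k L) ∈ J := h ▸ Submodule.mem_top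
    have h1 : φ 1 1 = 0 := this
    rw [map_one φ, Module.End.one_apply] at h1
    exact one_ne_zero h1
  obtain ⟨I, hI, hJI⟩ := Ideal.exists_le_maximal J hJ
  refine ⟨UniversalEnvelopingAlgebra k L ⧸ (I : Submodule _ _), inferInstance, inferInstance,
    ?_, ?_⟩
  · exact isSimpleModule_iff_isCoatom.2 hI.1
  · intro z m
    obtain ⟨w, rfl⟩ := Submodule.Quotient.mk_surjective _ m
    rw [← Submodule.Quotient.mk_smul, ← Submodule.Quotient.mk_smul, Submodule.Quotient.eq]
    have hc : ∀ w : UniversalEnvelopingAlgebra k L,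
        UniversalEnvelopingAlgebra.ι k (z : L) * w = w * UniversalEnvelopingAlgebra.ι k (z : L) := by
      exact CentralChar.central_comm _ (hz z)
    rw [smul_eq_mul, smul_eq_mul, hc, Algebra.commutes, ← mul_sub]
    apply I.smul_mem
    apply hJI
    change φ _ 1 = 0
    rw [map_sub, AlgHom.commutes, LinearMap.sub_apply, UniversalEnvelopingAlgebra.lift_ι_apply,
      CentralChar.rep_center b g _ (hz z), hg']
    simp
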